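/- arXiv:1102.0877 — 3 statements merged into one kernel-verified Lean document; each statement's English description precedes it below -/
import Mathlib

section
/- Let f ∈ C([0,1]) be time-independent and let u be a classical solution of the bridge equation with forcing term f. Then the Lyapunov functional 𝓛(t) = E(t) − 2⟨u(t,·), f⟩ is differentiable on (0,∞) with 𝓛'(t) = −2‖∂ₜu(t,·)‖² ≤ 0; in particular 𝓛 is nonincreasing along the solution. -/
open Real MeasureTheory

noncomputable section

/-- The `L²(0,1)` inner product `⟨u,v⟩`. -/
def ipL2 (u v : ℝ → ℝ) : ℝ := ∫ x in (0:ℝ)..1, u x * v x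

/-- The squared `L²(0,1)` norm `‖u‖²`. -/
def nsqL2 (u : ℝ → ℝ) : ℝ := ∫ x in (0:ℝ)..1, (u x) ^ 2

/-- Partial derivative in time. -/
def Dt (u : ℝ → ℝ → ℝ) : ℝ → ℝ → ℝ := fun t x => deriv (fun s => u s x) t

/-- Partial derivative in space. -/
def Dx (u : ℝ → ℝ → ℝ) : ℝ → ℝ → ℝ := fun t x => deriv (fun y => u t y) x

/-- A classical solution of the suspension-bridge equation
`∂ₜₜu + ∂ₓₓₓₓu + (p − ‖∂ₓu‖²)∂ₓₓu + ∂ₜu + k²u⁺ = f` on `[0,∞) × [0,1]`,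
smooth up to the boundary, with pinned boundary conditions. -/
def IsClassicalSolution (p k : ℝ) (f u : ℝ → ℝ → ℝ) : Prop :=
  ContDiff ℝ (⊤ : ℕ∞) (Function.uncurry u) ∧
  (∀ t ≥ (0:ℝ), ∀ x ∈ Set.Icc (0:ℝ) 1,
    Dt (Dt u) t x + Dx (Dx (Dx (Dx u))) t x
      + (p - nsqL2 (Dx u t)) * Dx (Dx u) t x
      + Dt u t x + k ^ 2 * max (u t x) 0 = f t x) ∧
  (∀ t ≥ (0:ℝ), u t 0 = 0 ∧ u t 1 = 0 ∧ Dx (Dx u) t 0 = 0 ∧ Dx (Dx u) t 1 = 0)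

/-- The energy `E(t) = ‖∂ₜu‖² + ‖∂ₓₓu‖² + ½(‖∂ₓu‖² − p)² + k²‖u⁺‖²`. -/
def energy (p k : ℝ) (u : ℝ → ℝ → ℝ) (t : ℝ) : ℝ :=
  nsqL2 (Dt u t) + nsqL2 (Dx (Dx u) t)
    + (1 / 2) * (nsqL2 (Dx u t) - p) ^ 2 + k ^ 2 * nsqL2 (fun x => max (u t x) 0)

/-- The reduced energy `𝓔(t) = ‖∂ₜu‖² + ‖∂ₓₓu‖²`. -/
def redEnergy (u : ℝ → ℝ → ℝ) (t : ℝ) : ℝ :=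
  nsqL2 (Dt u t) + nsqL2 (Dx (Dx u) t)

open scoped ContDiff

section PartialDerivatives

variable {u : ℝ → ℝ → ℝ}

lemma Dt_eq_fderiv (hu : ContDiff ℝ ∞ (Function.uncurry u)) (t x : ℝ) :
    Dt u t x = fderiv ℝ (Function.uncurry u) (t, x) (1, 0) := by
  have h := ((hu.differentiable (by simp)) (t, x)).hasFDerivAt.comp_hasDerivAt t
    ((hasDerivAt_id t).prodMk (hasDerivAt_const t x))
  exact h.deriv

lemma Dx_eq_fderiv (hu : ContDiff ℝ ∞ (Function.uncurry u)) (t x : ℝ) :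
    Dx u t x = fderiv ℝ (Function.uncurry u) (t, x) (0, 1) := by
  have h := ((hu.differentiable (by simp)) (t, x)).hasFDerivAt.comp_hasDerivAt x
    ((hasDerivAt_const x t).prodMk (hasDerivAt_id x))
  exact h.deriv

lemma contDiff_Dt (hu : ContDiff ℝ ∞ (Function.uncurry u)) :
    ContDiff ℝ ∞ (Function.uncurry (Dt u)) := by
  have h : Function.uncurry (Dt u) = fun q => fderiv ℝ (Function.uncurry u) q (1, 0) :=
    funext fun q => Dt_eq_fderiv hu q.1 q.2
  rw [h]
  exact (hu.fderiv_right (by simp)).clm_apply contDiff_const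

lemma contDiff_Dx (hu : ContDiff ℝ ∞ (Function.uncurry u)) :
    ContDiff ℝ ∞ (Function.uncurry (Dx u)) := by
  have h : Function.uncurry (Dx u) = fun q => fderiv ℝ (Function.uncurry u) q (0, 1) :=
    funext fun q => Dx_eq_fderiv hu q.1 q.2
  rw [h]
  exact (hu.fderiv_right (by simp)).clm_apply contDiff_const

lemma hasDerivAt_Dt (hu : ContDiff ℝ ∞ (Function.uncurry u)) (t x : ℝ) :
    HasDerivAt (fun s => u s x) (Dt u t x) t := by
  have h : Differentiable ℝ (fun s => u s x) :=
    (hu.comp (contDiff_id.prodMk contDiff_const)).differentiable (by simp)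
  exact (h t).hasDerivAt

lemma hasDerivAt_Dx (hu : ContDiff ℝ ∞ (Function.uncurry u)) (t x : ℝ) :
    HasDerivAt (u t) (Dx u t x) x := by
  have h : Differentiable ℝ (u t) :=
    (hu.comp (contDiff_const.prodMk contDiff_id)).differentiable (by simp)
  exact (h x).hasDerivAt

lemma continuous_slice (hu : ContDiff ℝ ∞ (Function.uncurry u)) (t : ℝ) :
    Continuous (u t) :=
  hu.continuous.comp (Continuous.prodMk_right t)

lemma Dt_Dx_comm (hu : ContDiff ℝ ∞ (Function.uncurry u)) : Dt (Dx u) = Dx (Dt u) := by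
  have hd : Differentiable ℝ (fderiv ℝ (Function.uncurry u)) :=
    (hu.fderiv_right (m := ∞) (by simp)).differentiable (by simp)
  funext t x
  have hx : Function.uncurry (Dx u) = fun q => fderiv ℝ (Function.uncurry u) q (0, 1) :=
    funext fun q => Dx_eq_fderiv hu q.1 q.2
  have ht : Function.uncurry (Dt u) = fun q => fderiv ℝ (Function.uncurry u) q (1, 0) :=
    funext fun q => Dt_eq_fderiv hu q.1 q.2
  rw [Dt_eq_fderiv (contDiff_Dx hu), Dx_eq_fderiv (contDiff_Dt hu), hx, ht,
    fderiv_clm_apply (hd _) (differentiableAt_const _),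
    fderiv_clm_apply (hd _) (differentiableAt_const _)]
  have h : IsSymmSndFDerivAt ℝ (Function.uncurry u) (t, x) :=
    hu.contDiffAt.isSymmSndFDerivAt
      (by simpa using WithTop.coe_le_coe.2 (le_top : (2 : ℕ∞) ≤ ⊤))
  simpa using h.eq (1, 0) (0, 1)

end PartialDerivatives

lemma hasDerivAt_intervalIntegral_of_continuous_deriv {a b : ℝ} {F F' : ℝ → ℝ → ℝ}
    (hF : ∀ t, Continuous (F t)) (hF' : Continuous fun q : ℝ × ℝ => F' q.1 q.2)
    (h : ∀ t x, HasDerivAt (fun s => F s x) (F' t x) t) (t : ℝ) :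
    HasDerivAt (fun s => ∫ x in a..b, F s x) (∫ x in a..b, F' t x) t := by
  obtain ⟨C, hC⟩ := ((isCompact_closedBall t 1).prod (isCompact_uIcc (a := a) (b := b)))
    |>.exists_bound_of_continuousOn hF'.continuousOn
  refine (intervalIntegral.hasDerivAt_integral_of_dominated_loc_of_deriv_le
    (bound := fun _ => C) (Metric.closedBall_mem_nhds t one_pos)
    (.of_forall fun s => (hF s).aestronglyMeasurable) ((hF t).intervalIntegrable _ _)
    (hF'.comp (Continuous.prodMk_right t)).aestronglyMeasurable
    (.of_forall fun x hx s hs => hC (s, x) ⟨hs, Set.uIoc_subset_uIcc hx⟩)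
    intervalIntegrable_const (.of_forall fun x _ s _ => h s x)).2

lemma hasDerivAt_max_zero_sq (r : ℝ) :
    HasDerivAt (fun r : ℝ => max r 0 ^ 2) (2 * max r 0) r := by
  rcases lt_trichotomy r 0 with hr | rfl | hr
  · rw [max_eq_right hr.le, mul_zero]
    refine (hasDerivAt_const r (0 : ℝ)).congr_of_eventuallyEq ?_
    filter_upwards [Iio_mem_nhds hr] with s hs
    simp [max_eq_right (Set.mem_Iio.1 hs).le]
  · rw [max_self, mul_zero, hasDerivAt_iff_isLittleO_nhds_zero]
    have h : (fun s : ℝ => s ^ 2) =o[nhds 0] fun s => s := by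
      simpa using Asymptotics.isLittleO_pow_pow (𝕜 := ℝ) one_lt_two
    refine Asymptotics.IsBigO.trans_isLittleO (.of_bound 1 (.of_forall fun s => ?_)) h
    rcases le_total s 0 with hs | hs
    · simp [max_eq_right hs, sq_nonneg]
    · simp [max_eq_left hs]
  · rw [max_eq_left hr.le]
    have h : HasDerivAt (fun s : ℝ => s ^ 2) (2 * r) r := by simpa using hasDerivAt_pow 2 r
    refine h.congr_of_eventuallyEq ?_
    filter_upwards [Ioi_mem_nhds hr] with s hs
    simp [max_eq_left (Set.mem_Ioi.1 hs).le]

lemma nsqL2_nonneg (v : ℝ → ℝ) : 0 ≤ nsqL2 v :=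
  intervalIntegral.integral_nonneg zero_le_one fun _ _ => sq_nonneg _

section Functionals

variable {u : ℝ → ℝ → ℝ}

lemma hasDerivAt_nsqL2 (hu : ContDiff ℝ ∞ (Function.uncurry u)) (t : ℝ) :
    HasDerivAt (fun s => nsqL2 (u s)) (2 * ipL2 (u t) (Dt u t)) t := by
  have h := hasDerivAt_intervalIntegral_of_continuous_deriv (a := 0) (b := 1)
    (F := fun s x => u s x ^ 2) (F' := fun s x => 2 * (u s x * Dt u s x))
    (fun s => (continuous_slice hu s).pow 2)
    (continuous_const.fun_mul (hu.continuous.fun_mul (contDiff_Dt hu).continuous))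
    (fun s x => by simpa [mul_assoc] using (hasDerivAt_Dt hu s x).fun_pow 2) t
  rwa [intervalIntegral.integral_const_mul] at h

lemma hasDerivAt_nsqL2_max_zero (hu : ContDiff ℝ ∞ (Function.uncurry u)) (t : ℝ) :
    HasDerivAt (fun s => nsqL2 fun x => max (u s x) 0)
      (2 * ipL2 (fun x => max (u t x) 0) (Dt u t)) t := by
  have h := hasDerivAt_intervalIntegral_of_continuous_deriv (a := 0) (b := 1)
    (F := fun s x => max (u s x) 0 ^ 2) (F' := fun s x => 2 * (max (u s x) 0 * Dt u s x))
    (fun s => ((continuous_slice hu s).max continuous_const).pow 2)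
    (continuous_const.fun_mul
      ((hu.continuous.max continuous_const).fun_mul (contDiff_Dt hu).continuous))
    (fun s x => by
      simpa [mul_assoc, Function.comp_def] using
        (hasDerivAt_max_zero_sq (u s x)).comp s (hasDerivAt_Dt hu s x)) t
  rwa [intervalIntegral.integral_const_mul] at h

lemma hasDerivAt_ipL2_left {f : ℝ → ℝ} (hf : Continuous f)
    (hu : ContDiff ℝ ∞ (Function.uncurry u)) (t : ℝ) :
    HasDerivAt (fun s => ipL2 (u s) f) (ipL2 (Dt u t) f) t :=
  hasDerivAt_intervalIntegral_of_continuous_deriv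
    (F := fun s x => u s x * f x) (F' := fun s x => Dt u s x * f x)
    (fun s => (continuous_slice hu s).mul hf)
    ((contDiff_Dt hu).continuous.mul (hf.comp continuous_snd))
    (fun s x => (hasDerivAt_Dt hu s x).mul_const (f x)) t

lemma ipL2_Dx_right {v w : ℝ → ℝ → ℝ} (hv : ContDiff ℝ ∞ (Function.uncurry v))
    (hw : ContDiff ℝ ∞ (Function.uncurry w)) (t : ℝ)
    (h0 : v t 0 * w t 0 = 0) (h1 : v t 1 * w t 1 = 0) :
    ipL2 (v t) (Dx w t) = -ipL2 (Dx v t) (w t) := by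
  have h := intervalIntegral.integral_mul_deriv_eq_deriv_mul (a := 0) (b := 1)
    (fun x _ => hasDerivAt_Dx hv t x) (fun x _ => hasDerivAt_Dx hw t x)
    ((continuous_slice (contDiff_Dx hv) t).intervalIntegrable _ _)
    ((continuous_slice (contDiff_Dx hw) t).intervalIntegrable _ _)
  rw [h0, h1] at h
  simpa [ipL2] using h

lemma Dt_eq_zero_of_forall_nonneg (hu : ContDiff ℝ ∞ (Function.uncurry u)) {x : ℝ}
    (h : ∀ t ≥ (0 : ℝ), u t x = 0) {t : ℝ} (ht : 0 < t) : Dt u t x = 0 := by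
  refine (hasDerivAt_Dt hu t x).unique
    ((hasDerivAt_const t (0 : ℝ)).congr_of_eventuallyEq ?_)
  filter_upwards [Ioi_mem_nhds ht] with s hs using h s (Set.mem_Ioi.1 hs).le

end Functionals

namespace IsClassicalSolution

variable {p k : ℝ} {f : ℝ → ℝ} {u : ℝ → ℝ → ℝ}

lemma nsqL2_Dt_eq (hf : Continuous f) (hu : IsClassicalSolution p k (fun _ x => f x) u)
    {t : ℝ} (ht : 0 ≤ t) :
    nsqL2 (Dt u t) = ipL2 (Dt u t) f - ipL2 (Dt u t) (Dt (Dt u) t)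
      - ipL2 (Dx (Dx (Dx (Dx u))) t) (Dt u t)
      - (p - nsqL2 (Dx u t)) * ipL2 (Dx (Dx u) t) (Dt u t)
      - k ^ 2 * ipL2 (fun x => max (u t x) 0) (Dt u t) := by
  obtain ⟨hs, heq, -⟩ := hu
  have c0 := continuous_slice hs t
  have c1 := continuous_slice (contDiff_Dt hs) t
  have c2 := continuous_slice (contDiff_Dt (contDiff_Dt hs)) t
  have c3 := continuous_slice (contDiff_Dx (contDiff_Dx hs)) t
  have c4 := continuous_slice (contDiff_Dx (contDiff_Dx (contDiff_Dx (contDiff_Dx hs)))) t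
  have cm : Continuous fun x => max (u t x) 0 := c0.max continuous_const
  simp only [ipL2, ← intervalIntegral.integral_const_mul]
  rw [← intervalIntegral.integral_sub, ← intervalIntegral.integral_sub,
    ← intervalIntegral.integral_sub, ← intervalIntegral.integral_sub, nsqL2]
  · refine intervalIntegral.integral_congr fun x hx => ?_
    rw [Set.uIcc_of_le zero_le_one] at hx
    simp only [← heq t ht x hx]
    ring
  all_goals exact Continuous.intervalIntegrable (by fun_prop) _ _

lemma hasDerivAt_lyapunov (hf : Continuous f)
    (hu : IsClassicalSolution p k (fun _ x => f x) u) {t : ℝ} (ht : 0 < t) :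
    HasDerivAt (fun s => energy p k u s - 2 * ipL2 (u s) f) (-2 * nsqL2 (Dt u t)) t := by
  have hid := hu.nsqL2_Dt_eq hf ht.le
  obtain ⟨hs, -, hb⟩ := hu
  have ht0 : Dt u t 0 = 0 := Dt_eq_zero_of_forall_nonneg hs (fun s hs => (hb s hs).1) ht
  have ht1 : Dt u t 1 = 0 := Dt_eq_zero_of_forall_nonneg hs (fun s hs => (hb s hs).2.1) ht
  obtain ⟨-, -, hx0, hx1⟩ := hb t ht.le
  have st := contDiff_Dt hs
  have s1 := contDiff_Dx hs
  have s2 := contDiff_Dx s1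
  have s3 := contDiff_Dx s2
  have hcomm : Dt (Dx (Dx u)) = Dx (Dx (Dt u)) := by rw [Dt_Dx_comm s1, Dt_Dx_comm hs]
  have i1 : ipL2 (Dx u t) (Dx (Dt u) t) = -ipL2 (Dx (Dx u) t) (Dt u t) :=
    ipL2_Dx_right s1 st t (by simp [ht0]) (by simp [ht1])
  have i2 : ipL2 (Dx (Dx u) t) (Dx (Dx (Dt u)) t)
      = ipL2 (Dx (Dx (Dx (Dx u))) t) (Dt u t) := by
    rw [ipL2_Dx_right s2 (contDiff_Dx st) t (by simp [hx0]) (by simp [hx1]),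
      ipL2_Dx_right s3 st t (by simp [ht0]) (by simp [ht1]), neg_neg]
  have h := (((((hasDerivAt_nsqL2 st t).add (hasDerivAt_nsqL2 s2 t)).add
    ((((hasDerivAt_nsqL2 s1 t).sub_const p).pow 2).const_mul (1 / 2))).add
    ((hasDerivAt_nsqL2_max_zero hs t).const_mul (k ^ 2))).sub
    ((hasDerivAt_ipL2_left hf hs t).const_mul 2))
  rw [hcomm, Dt_Dx_comm hs, i1, i2] at h
  refine h.congr_deriv ?_
  rw [hid]
  push_cast
  ring

lemma continuous_lyapunov (hf : Continuous f)
    (hu : IsClassicalSolution p k (fun _ x => f x) u) :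
    Continuous fun s => energy p k u s - 2 * ipL2 (u s) f := by
  have hs := hu.1
  have s1 := contDiff_Dx hs
  have continuous_of {g g' : ℝ → ℝ} (h : ∀ t, HasDerivAt g (g' t) t) : Continuous g :=
    continuous_iff_continuousAt.2 fun t => (h t).continuousAt
  have c1 := continuous_of (hasDerivAt_nsqL2 (contDiff_Dt hs))
  have c2 := continuous_of (hasDerivAt_nsqL2 (contDiff_Dx s1))
  have c3 := continuous_of (hasDerivAt_nsqL2 s1)
  have c4 := continuous_of (hasDerivAt_nsqL2_max_zero hs)
  have c5 := continuous_of (hasDerivAt_ipL2_left hf hs)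
  unfold energy
  fun_prop

end IsClassicalSolution

/-- For a time-independent forcing `f`, the Lyapunov functional
`𝓛(t) = E(t) − 2⟨u(t,·), f⟩` is differentiable on `(0,∞)` with
`𝓛'(t) = −2‖∂ₜu(t,·)‖² ≤ 0`; in particular `𝓛` is nonincreasing along the solution. -/
theorem lyapunov_functional (p k : ℝ) (f : ℝ → ℝ) (hf : Continuous f)
    (u : ℝ → ℝ → ℝ) (hu : IsClassicalSolution p k (fun _ x => f x) u) :
    (∀ t > (0:ℝ), HasDerivAt (fun s => energy p k u s - 2 * ipL2 (u s) f)
        (-2 * nsqL2 (Dt u t)) t ∧ -2 * nsqL2 (Dt u t) ≤ 0) ∧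
    (∀ s t : ℝ, 0 ≤ s → s ≤ t →
      energy p k u t - 2 * ipL2 (u t) f ≤ energy p k u s - 2 * ipL2 (u s) f) := by
  have hneg (t : ℝ) : -2 * nsqL2 (Dt u t) ≤ 0 := by linarith [nsqL2_nonneg (Dt u t)]
  refine ⟨fun t ht => ⟨hu.hasDerivAt_lyapunov hf ht, hneg t⟩, fun s t hs hst => ?_⟩
  refine antitoneOn_of_hasDerivWithinAt_nonpos (convex_Ici 0)
    (hu.continuous_lyapunov hf).continuousOn
    (fun r hr => (hu.hasDerivAt_lyapunov hf ?_).hasDerivWithinAt) (fun r _ => hneg r)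
    hs (hs.trans hst) hst
  simpa using hr
end
end

section
/- Let b ≥ 1 and set A₁⁻ = −√(2(b−1)). Then the function u(x) = A₁⁻·sin(πx) is a stationary solution of the bridge problem with κ = 1; that is, u ∈ C⁴([0,1]), u(0) = u(1) = u''(0) = u''(1) = 0, and u''''(x) + (bπ² − ∫₀¹ (u'(y))² dy)·u''(x) + π⁴·max(u(x),0) = 0 for all x ∈ [0,1]. -/
open Real MeasureTheory

noncomputable section

/-- The buckled branch `u₁⁻(x) = A₁⁻ sin(πx)`, `A₁⁻ = −√(2(b−1))`. -/
def buckledMinus (b : ℝ) : ℝ → ℝ := fun x => -Real.sqrt (2 * (b - 1)) * Real.sin (π * x)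

theorem deriv_const_mul_sin_mul (c a : ℝ) :
    deriv (fun x => c * Real.sin (a * x)) = fun x => c * a * Real.cos (a * x) := by
  funext x
  have h : HasDerivAt (fun x => a * x) a x := by simpa using (hasDerivAt_id x).const_mul a
  rw [(h.sin.const_mul c).deriv]
  ring

theorem deriv_const_mul_cos_mul (c a : ℝ) :
    deriv (fun x => c * Real.cos (a * x)) = fun x => -(c * a) * Real.sin (a * x) := by
  funext x
  have h : HasDerivAt (fun x => a * x) a x := by simpa using (hasDerivAt_id x).const_mul a
  rw [(h.cos.const_mul c).deriv]
  ring

theorem integral_cos_pi_mul_sq : ∫ y in (0 : ℝ)..1, Real.cos (π * y) ^ 2 = 1 / 2 := by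
  rw [intervalIntegral.integral_comp_mul_left (fun y => Real.cos y ^ 2) pi_ne_zero,
    integral_cos_sq]
  simp only [mul_one, mul_zero, Real.sin_pi, Real.sin_zero, smul_eq_mul]
  field_simp
  ring

theorem deriv_buckledMinus (b : ℝ) :
    deriv (buckledMinus b) = fun x => -√(2 * (b - 1)) * π * Real.cos (π * x) :=
  deriv_const_mul_sin_mul _ _

theorem deriv_deriv_buckledMinus (b : ℝ) :
    deriv (deriv (buckledMinus b)) =
      fun x => -(-√(2 * (b - 1)) * π * π) * Real.sin (π * x) := by
  rw [deriv_buckledMinus, deriv_const_mul_cos_mul]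

theorem integral_deriv_buckledMinus_sq {b : ℝ} (hb : 1 ≤ b) :
    ∫ y in (0 : ℝ)..1, (deriv (buckledMinus b) y) ^ 2 = (b - 1) * π ^ 2 := by
  simp only [deriv_buckledMinus, mul_pow, neg_sq]
  rw [Real.sq_sqrt (by linarith), intervalIntegral.integral_const_mul, integral_cos_pi_mul_sq]
  ring

theorem buckledMinus_nonpos (b : ℝ) {x : ℝ} (hx : x ∈ Set.Icc (0 : ℝ) 1) :
    buckledMinus b x ≤ 0 := by
  have hsin : 0 ≤ Real.sin (π * x) :=
    Real.sin_nonneg_of_nonneg_of_le_pi (mul_nonneg pi_pos.le hx.1)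
      (mul_le_of_le_one_right pi_pos.le hx.2)
  exact mul_nonpos_of_nonpos_of_nonneg (neg_nonpos.2 (Real.sqrt_nonneg _)) hsin

/-- For `b ≥ 1`, the function `u(x) = −√(2(b−1))·sin(πx)` is a stationary solution of
the bridge problem with `κ = 1`: it is `C⁴`, satisfies the pinned boundary conditions,
and solves `u'''' + (bπ² − ‖u'‖²)u'' + π⁴u⁺ = 0` on `[0,1]`. -/
theorem buckledMinus_is_stationary (b : ℝ) (hb : 1 ≤ b) :
    ContDiff ℝ 4 (buckledMinus b) ∧
    buckledMinus b 0 = 0 ∧ buckledMinus b 1 = 0 ∧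
    deriv (deriv (buckledMinus b)) 0 = 0 ∧ deriv (deriv (buckledMinus b)) 1 = 0 ∧
    ∀ x ∈ Set.Icc (0:ℝ) 1,
      deriv (deriv (deriv (deriv (buckledMinus b)))) x
        + (b * π ^ 2 - ∫ y in (0:ℝ)..1, (deriv (buckledMinus b) y) ^ 2)
            * deriv (deriv (buckledMinus b)) x
        + π ^ 4 * max (buckledMinus b x) 0 = 0 := by
  refine ⟨?_, by simp [buckledMinus], by simp [buckledMinus], by simp [deriv_deriv_buckledMinus],
    by simp [deriv_deriv_buckledMinus], fun x hx => ?_⟩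
  · unfold buckledMinus
    fun_prop
  · rw [max_eq_right (buckledMinus_nonpos b hx), integral_deriv_buckledMinus_sq hb,
      deriv_deriv_buckledMinus, deriv_const_mul_sin_mul, deriv_const_mul_cos_mul]
    ring
end
end

section
/- Let f : [0,∞) × [0,1] → ℝ be continuous and let u be a classical solution of the bridge equation with forcing term f. Then the functional Υ(t) = ⟨u(t,·), ∂ₜu(t,·)⟩ is differentiable on (0,∞) and satisfies, for every t > 0, Υ'(t) + Υ(t) + ‖∂ₓₓu(t,·)‖² + (‖∂ₓu(t,·)‖² − p)² + p(‖∂ₓu(t,·)‖² − p) + k²‖u⁺(t,·)‖² − ⟨u(t,·), f(t,·)⟩ = ‖∂ₜu(t,·)‖². -/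
open Real MeasureTheory

noncomputable section

lemma hasDerivAt_time {v : ℝ → ℝ → ℝ} (hv : ContDiff ℝ (⊤ : ℕ∞) (Function.uncurry v)) (t x : ℝ) :
    HasDerivAt (fun s => v s x) (Dt v t x) t := by
  have h : ContDiff ℝ (⊤ : ℕ∞) (fun s => v s x) :=
    hv.comp (contDiff_id.prodMk contDiff_const)
  exact (h.differentiable (by simp) t).hasDerivAt

lemma hasDerivAt_space {v : ℝ → ℝ → ℝ} (hv : ContDiff ℝ (⊤ : ℕ∞) (Function.uncurry v)) (t x : ℝ) :
    HasDerivAt (v t) (Dx v t x) x := by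
  have h : ContDiff ℝ (⊤ : ℕ∞) (v t) := hv.comp (contDiff_const.prodMk contDiff_id)
  exact (h.differentiable (by simp) x).hasDerivAt

lemma contDiff_Dt_s15 {v : ℝ → ℝ → ℝ} (hv : ContDiff ℝ (⊤ : ℕ∞) (Function.uncurry v)) :
    ContDiff ℝ (⊤ : ℕ∞) (Function.uncurry (Dt v)) := by
  have h : Function.uncurry (Dt v) = fun z => fderiv ℝ (Function.uncurry v) z (1, 0) := by
    ext ⟨t, x⟩
    have h₁ := (hv.differentiable (by simp) (t, x)).hasFDerivAt
    have h₂ : HasDerivAt (fun s : ℝ => (s, x)) ((1 : ℝ), (0 : ℝ)) t :=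
      (hasDerivAt_id t).prodMk (hasDerivAt_const t x)
    exact (h₁.comp_hasDerivAt t h₂).deriv
  rw [h]
  exact (hv.fderiv_right (by simp)).clm_apply contDiff_const

lemma contDiff_Dx_s15 {v : ℝ → ℝ → ℝ} (hv : ContDiff ℝ (⊤ : ℕ∞) (Function.uncurry v)) :
    ContDiff ℝ (⊤ : ℕ∞) (Function.uncurry (Dx v)) := by
  have h : Function.uncurry (Dx v) = fun z => fderiv ℝ (Function.uncurry v) z (0, 1) := by
    ext ⟨t, x⟩
    have h₁ := (hv.differentiable (by simp) (t, x)).hasFDerivAt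
    have h₂ : HasDerivAt (fun y : ℝ => (t, y)) ((0 : ℝ), (1 : ℝ)) x :=
      (hasDerivAt_const x t).prodMk (hasDerivAt_id x)
    exact (h₁.comp_hasDerivAt x h₂).deriv
  rw [h]
  exact (hv.fderiv_right (by simp)).clm_apply contDiff_const

/-- Differentiation under the integral sign for a jointly continuous time derivative. -/
lemma hasDerivAt_intervalIntegral_of_continuous {g g' : ℝ → ℝ → ℝ} {a b : ℝ}
    (hg : Continuous (Function.uncurry g)) (hg' : Continuous (Function.uncurry g'))
    (h : ∀ t x, HasDerivAt (fun s => g s x) (g' t x) t) (t : ℝ) :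
    HasDerivAt (fun s => ∫ x in a..b, g s x) (∫ x in a..b, g' t x) t := by
  have hgx : ∀ s, Continuous (g s) := fun s => hg.comp (by fun_prop : Continuous fun x => (s, x))
  have hgx' : ∀ s, Continuous (g' s) :=
    fun s => hg'.comp (by fun_prop : Continuous fun x => (s, x))
  obtain ⟨C, hC⟩ := ((isCompact_closedBall t 1).prod (isCompact_uIcc (a := a) (b := b))
    ).exists_bound_of_continuousOn hg'.continuousOn
  refine (intervalIntegral.hasDerivAt_integral_of_dominated_loc_of_deriv_le
    (bound := fun _ => C) (Metric.ball_mem_nhds t one_pos)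
    (.of_forall fun s => (hgx s).aestronglyMeasurable) ((hgx t).intervalIntegrable a b)
    (hgx' t).aestronglyMeasurable (.of_forall fun x hx s hs => ?_)
    intervalIntegrable_const (.of_forall fun x _ s _ => h s x)).2
  exact hC (s, x) ⟨Metric.ball_subset_closedBall hs, Set.uIoc_subset_uIcc hx⟩

lemma integral_mul_Dx {v w : ℝ → ℝ → ℝ} (hv : ContDiff ℝ (⊤ : ℕ∞) (Function.uncurry v))
    (hw : ContDiff ℝ (⊤ : ℕ∞) (Function.uncurry w)) (t : ℝ) :
    ipL2 (v t) (Dx w t) = v t 1 * w t 1 - v t 0 * w t 0 - ipL2 (Dx v t) (w t) := by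
  have hc : ∀ {z : ℝ → ℝ → ℝ}, ContDiff ℝ (⊤ : ℕ∞) (Function.uncurry z) → Continuous (z t) :=
    fun hz => hz.continuous.comp (by fun_prop : Continuous fun x => (t, x))
  exact intervalIntegral.integral_mul_deriv_eq_deriv_mul
    (fun x _ => hasDerivAt_space hv t x) (fun x _ => hasDerivAt_space hw t x)
    ((hc (contDiff_Dx_s15 hv)).intervalIntegrable _ _) ((hc (contDiff_Dx_s15 hw)).intervalIntegrable _ _)

lemma ipL2_self (v : ℝ → ℝ) : ipL2 v v = nsqL2 v := by
  simp only [ipL2, nsqL2, pow_two]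

/-- The differential identity for `Υ(t) = ⟨u(t,·), ∂ₜu(t,·)⟩`: for every `t > 0`, `Υ`
is differentiable at `t` and
`Υ' + Υ + ‖∂ₓₓu‖² + (‖∂ₓu‖² − p)² + p(‖∂ₓu‖² − p) + k²‖u⁺‖² − ⟨u,f⟩ = ‖∂ₜu‖²`. -/
theorem upsilon_identity (p k : ℝ) (f u : ℝ → ℝ → ℝ)
    (hf : Continuous (Function.uncurry f))
    (hu : IsClassicalSolution p k f u) :
    ∀ t > (0:ℝ), HasDerivAt (fun s => ipL2 (u s) (Dt u s))
      (nsqL2 (Dt u t)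
        - (ipL2 (u t) (Dt u t) + nsqL2 (Dx (Dx u) t)
            + (nsqL2 (Dx u t) - p) ^ 2 + p * (nsqL2 (Dx u t) - p)
            + k ^ 2 * nsqL2 (fun x => max (u t x) 0) - ipL2 (u t) (f t))) t := by
  intro t ht
  obtain ⟨hu, heq, hbc⟩ := hu
  obtain ⟨h0, h1, h20, h21⟩ := hbc t ht.le
  have hut := contDiff_Dt_s15 hu
  have hutt := contDiff_Dt_s15 hut
  have hux := contDiff_Dx_s15 hu
  have huxx := contDiff_Dx_s15 hux
  have huxxx := contDiff_Dx_s15 huxx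
  have huxxxx := contDiff_Dx_s15 huxxx
  have hslice : ∀ {z : ℝ → ℝ → ℝ}, Continuous (Function.uncurry z) → Continuous (z t) :=
    fun hz => hz.comp (by fun_prop : Continuous fun x => (t, x))
  have hderiv : HasDerivAt (fun s => ipL2 (u s) (Dt u s))
      (∫ x in (0:ℝ)..1, (Dt u t x * Dt u t x + u t x * Dt (Dt u) t x)) t :=
    hasDerivAt_intervalIntegral_of_continuous
      (g := fun s x => u s x * Dt u s x)
      (g' := fun s x => Dt u s x * Dt u s x + u s x * Dt (Dt u) s x)
      (hu.continuous.mul hut.continuous)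
      ((hut.continuous.mul hut.continuous).add (hu.continuous.mul hutt.continuous))
      (fun s x => (hasDerivAt_time hu s x).mul (hasDerivAt_time hut s x)) t
  have hxx : ipL2 (u t) (Dx (Dx u) t) = - nsqL2 (Dx u t) := by
    rw [integral_mul_Dx hu hux, h0, h1, ipL2_self]; ring
  have hxxxx : ipL2 (u t) (Dx (Dx (Dx (Dx u))) t) = nsqL2 (Dx (Dx u) t) := by
    rw [integral_mul_Dx hu huxxx, integral_mul_Dx hux huxx, h0, h1, h20, h21, ipL2_self]; ring
  convert hderiv using 1
  have c := hslice hu.continuous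
  have ct := hslice hut.continuous
  have cxx := hslice huxx.continuous
  have cxxxx := hslice huxxxx.continuous
  have cf := hslice hf
  have hint : (∫ x in (0:ℝ)..1, (Dt u t x * Dt u t x + u t x * Dt (Dt u) t x)) =
      ∫ x in (0:ℝ)..1, (Dt u t x ^ 2 + u t x * f t x - u t x * Dx (Dx (Dx (Dx u))) t x
        - (p - nsqL2 (Dx u t)) * (u t x * Dx (Dx u) t x) - u t x * Dt u t x
        - k ^ 2 * max (u t x) 0 ^ 2) := by
    refine intervalIntegral.integral_congr fun x hx => ?_
    rw [Set.uIcc_of_le zero_le_one] at hx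
    have hpos : u t x * max (u t x) 0 = max (u t x) 0 ^ 2 := by
      rcases le_total (u t x) 0 with h | h <;> simp [h, pow_two]
    rw [← heq t ht.le x hx, ← hpos]
    ring
  rw [hint, intervalIntegral.integral_sub, intervalIntegral.integral_sub,
    intervalIntegral.integral_sub, intervalIntegral.integral_sub, intervalIntegral.integral_add,
    intervalIntegral.integral_const_mul, intervalIntegral.integral_const_mul]
  · change _ = nsqL2 (Dt u t) + ipL2 (u t) (f t) - ipL2 (u t) (Dx (Dx (Dx (Dx u))) t)
      - (p - nsqL2 (Dx u t)) * ipL2 (u t) (Dx (Dx u) t) - ipL2 (u t) (Dt u t)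
      - k ^ 2 * nsqL2 (fun x => max (u t x) 0)
    rw [hxx, hxxxx]
    ring
  all_goals exact Continuous.intervalIntegrable (by fun_prop) _ _
end
end
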